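/- Let λ, δ, μ be partitions with |μ| ≤ |λ| + |δ|, and let θ = (θ_i)_{i≥1} be a sequence of positive real numbers with sup_i θ_i < 1. For r ≥ 1 set s_i = (λ_1+⋯+λ_i) + (δ_1+⋯+δ_i) − (μ_1+⋯+μ_i) (an integer, possibly negative) and τ_r = ∏_{i=1}^{r−1} θ_i^{s_i} (integer powers), and consider the ratio R_r = τ_r · S_μ^{(r)}(θ) / (S_λ^{(r)}(θ) · S_δ^{(r)}(θ)). Then: (1) if |μ| = |λ| + |δ|, the sequence (R_r) converges to the positive real number θ^{[λ+δ−μ]} · S_μ^{A}(θ) / (S_λ^{A}(θ) · S_δ^{A}(θ)), where θ^{[λ+δ−μ]} = ∏_{i=1}^{L−1} θ_i^{s_i} with L any index beyond which all three partitions have only zero parts (the product being independent of such L); (2) if |μ| < |λ| + |δ|, then R_r → 0 as r → ∞. -/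

import Mathlib

/-- A filling of the Young diagram `μ` with entries in `Fin r` (the value `v : Fin r`
representing the letter `v + 1` of the alphabet `{1, …, r}`) is semistandard if its rows
weakly increase from left to right and its columns strictly increase downwards.
Cells are pairs `(i, j)` with `i` the (0-indexed) row and `j` the (0-indexed) column. -/
def IsSSYT {μ : YoungDiagram} {r : ℕ} (T : ↥μ.cells → Fin r) : Prop :=
  (∀ c c' : ↥μ.cells, (c : ℕ × ℕ).1 = (c' : ℕ × ℕ).1 → (c : ℕ × ℕ).2 ≤ (c' : ℕ × ℕ).2 →
    T c ≤ T c') ∧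
  (∀ c c' : ↥μ.cells, (c : ℕ × ℕ).2 = (c' : ℕ × ℕ).2 → (c : ℕ × ℕ).1 < (c' : ℕ × ℕ).1 →
    T c < T c')

instance {μ : YoungDiagram} {r : ℕ} : DecidablePred (IsSSYT (μ := μ) (r := r)) :=
  fun T => by unfold IsSSYT; infer_instance

/-- The normalized Weyl character `S_λ^{(r)}(θ) = S_λ^{gl_r}(θ_{[r]})`, for a partition
`λ` encoded as the Young diagram `μ` (so `λ_{i+1} = μ.rowLen i`) and a sequence
`θ : ℕ → ℝ` of parameters (with `θ j` representing `θ_{j+1}`):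
`S_λ^{(r)}(θ) = Σ_T ∏_{i=1}^{r−1} θ_i^{c_i(T)}`, the sum being over all SSYT `T` of
shape `λ` with entries in `{1,…,r}`, where
`c_i(T) = (λ_1 + ⋯ + λ_i) − #{boxes of T with entry ≤ i}` (a nonnegative integer;
here a cell `c` has entry `(T c : ℕ) + 1`). -/
noncomputable def normalizedChar (μ : YoungDiagram) (r : ℕ) (θ : ℕ → ℝ) : ℝ :=
  ∑ T ∈ Finset.univ.filter (fun T : ↥μ.cells → Fin r => IsSSYT T),
    ∏ j ∈ Finset.range (r - 1),
      θ j ^ ((∑ k ∈ Finset.range (j + 1), μ.rowLen k) -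
        (Finset.univ.filter (fun c : ↥μ.cells => (T c : ℕ) ≤ j)).card)

open Filter

/-- The integer `s_i = (λ_1 + ⋯ + λ_i) + (δ_1 + ⋯ + δ_i) − (μ_1 + ⋯ + μ_i)`
(0-indexed: `partialDiff lam del mu j` is `s_{j+1}`). -/
def partialDiff (lam del mu : YoungDiagram) (j : ℕ) : ℤ :=
  ∑ k ∈ Finset.range (j + 1),
    ((lam.rowLen k : ℤ) + (del.rowLen k : ℤ) - (mu.rowLen k : ℤ))

open Finset in
theorem YoungDiagram.sum_range_rowLen (μ : YoungDiagram) (n : ℕ) :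
    ∑ k ∈ range n, μ.rowLen k = ∑ c : ↥μ.cells, if (c : ℕ × ℕ).1 < n then 1 else 0 := by
  rw [Finset.sum_coe_sort μ.cells (fun c : ℕ × ℕ => if c.1 < n then 1 else 0),
    ← Finset.card_filter,
    Finset.card_eq_sum_card_fiberwise (f := Prod.fst) (t := range n)
      (fun c hc => by simpa using (Finset.mem_filter.mp hc).2)]
  refine Finset.sum_congr rfl fun k hk => ?_
  rw [YoungDiagram.rowLen_eq_card]
  congr 1
  ext c
  have := Finset.mem_range.mp hk
  simp only [YoungDiagram.mem_row_iff, Finset.mem_filter, YoungDiagram.mem_cells]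
  constructor
  · rintro ⟨h, rfl⟩
    exact ⟨⟨h, this⟩, rfl⟩
  · rintro ⟨⟨h, -⟩, h'⟩
    exact ⟨h, h'⟩

theorem YoungDiagram.sum_range_rowLen_le_card (μ : YoungDiagram) (n : ℕ) :
    ∑ k ∈ Finset.range n, μ.rowLen k ≤ μ.card := by
  rw [μ.sum_range_rowLen, ← Finset.card_filter]
  exact (Finset.card_le_univ _).trans (by simp)

theorem YoungDiagram.sum_range_rowLen_eq_card (μ : YoungDiagram) {L n : ℕ}
    (hL : ∀ k, L ≤ k → μ.rowLen k = 0) (hn : L ≤ n) :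
    ∑ k ∈ Finset.range n, μ.rowLen k = μ.card := by
  have h : ∀ c : ↥μ.cells, (c : ℕ × ℕ).1 < n := fun c => by
    by_contra hc
    have h1 := YoungDiagram.mem_iff_lt_rowLen.mp
      (show ((c : ℕ × ℕ).1, (c : ℕ × ℕ).2) ∈ μ from c.2)
    rw [hL _ (by omega)] at h1
    exact absurd h1 (Nat.not_lt_zero _)
  rw [μ.sum_range_rowLen, Finset.sum_congr rfl fun c _ => if_pos (h c)]
  simp

theorem YoungDiagram.rowLen_eq_zero_of_colLen_le (μ : YoungDiagram) {k : ℕ}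
    (hk : μ.colLen 0 ≤ k) : μ.rowLen k = 0 := by
  by_contra h
  have h1 := YoungDiagram.mem_iff_lt_rowLen.mpr (Nat.pos_of_ne_zero h)
  exact absurd (YoungDiagram.mem_iff_lt_colLen.mp h1) (by omega)

theorem Finset.sum_range_ite_le (n a : ℕ) :
    ∑ j ∈ Finset.range n, (if a ≤ j then 1 else 0) = n - a := by
  induction n with
  | zero => simp
  | succ n ih => rw [Finset.sum_range_succ, ih]; split_ifs <;> omega

/-- The exponent of `θ j` in the term of `normalizedChar μ r θ` indexed by `T`. -/
def charExponent {μ : YoungDiagram} {r : ℕ} (T : ↥μ.cells → Fin r) (j : ℕ) : ℕ :=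
  (∑ k ∈ Finset.range (j + 1), μ.rowLen k) -
    (Finset.univ.filter (fun c : ↥μ.cells => (T c : ℕ) ≤ j)).card

theorem normalizedChar_eq (μ : YoungDiagram) (r : ℕ) (θ : ℕ → ℝ) :
    normalizedChar μ r θ = ∑ T ∈ Finset.univ.filter (fun T : ↥μ.cells → Fin r => IsSSYT T),
      ∏ j ∈ Finset.range (r - 1), θ j ^ charExponent T j := rfl

theorem sum_entries_le {μ : YoungDiagram} {r : ℕ} (T : ↥μ.cells → Fin r) :
    ∑ c, (T c : ℕ) ≤
      ∑ j ∈ Finset.range (r - 1), charExponent T j + ∑ c : ↥μ.cells, (c : ℕ × ℕ).1 := by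
  have h1 : ∑ j ∈ Finset.range (r - 1), ∑ k ∈ Finset.range (j + 1), μ.rowLen k =
      ∑ c : ↥μ.cells, (r - 1 - (c : ℕ × ℕ).1) := by
    simp_rw [μ.sum_range_rowLen, Nat.lt_succ_iff]
    rw [Finset.sum_comm]
    simp_rw [Finset.sum_range_ite_le]
  have h2 : ∑ j ∈ Finset.range (r - 1),
      (Finset.univ.filter (fun c : ↥μ.cells => (T c : ℕ) ≤ j)).card =
      ∑ c : ↥μ.cells, (r - 1 - (T c : ℕ)) := by
    simp_rw [Finset.card_filter]
    rw [Finset.sum_comm]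
    simp_rw [Finset.sum_range_ite_le]
  have h3 : ∑ j ∈ Finset.range (r - 1), ∑ k ∈ Finset.range (j + 1), μ.rowLen k ≤
      ∑ j ∈ Finset.range (r - 1), charExponent T j + ∑ j ∈ Finset.range (r - 1),
      (Finset.univ.filter (fun c : ↥μ.cells => (T c : ℕ) ≤ j)).card := by
    rw [← Finset.sum_add_distrib]
    exact Finset.sum_le_sum fun j _ => by unfold charExponent; omega
  have h4 : ∑ c, (T c : ℕ) + ∑ c : ↥μ.cells, (r - 1 - (T c : ℕ)) ≤
      ∑ c : ↥μ.cells, (r - 1 - (c : ℕ × ℕ).1) + ∑ c : ↥μ.cells, (c : ℕ × ℕ).1 := by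
    rw [← Finset.sum_add_distrib, ← Finset.sum_add_distrib]
    exact Finset.sum_le_sum fun c _ => by have := (T c).2; omega
  omega

theorem normalizedChar_le (μ : YoungDiagram) (r : ℕ) {θ : ℕ → ℝ} (hpos : ∀ i, 0 < θ i)
    {b : ℝ} (hb : b < 1) (hub : ∀ i, θ i ≤ b) :
    normalizedChar μ r θ ≤
      (b ^ ∑ c : ↥μ.cells, (c : ℕ × ℕ).1)⁻¹ * ∏ _c : ↥μ.cells, (1 - b)⁻¹ := by
  have hb0 : 0 < b := (hpos 0).trans_le (hub 0)
  set N := ∑ c : ↥μ.cells, (c : ℕ × ℕ).1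
  have hterm : ∀ T : ↥μ.cells → Fin r,
      ∏ j ∈ Finset.range (r - 1), θ j ^ charExponent T j ≤
        (b ^ N)⁻¹ * ∏ c, b ^ (T c : ℕ) := fun T => by
    calc ∏ j ∈ Finset.range (r - 1), θ j ^ charExponent T j
        ≤ ∏ j ∈ Finset.range (r - 1), b ^ charExponent T j :=
          Finset.prod_le_prod (fun j _ => (pow_pos (hpos j) _).le)
            fun j _ => pow_le_pow_left₀ (hpos j).le (hub j) _
      _ = b ^ ∑ j ∈ Finset.range (r - 1), charExponent T j := Finset.prod_pow_eq_pow_sum _ _ _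
      _ ≤ (b ^ N)⁻¹ * ∏ c, b ^ (T c : ℕ) := by
          rw [Finset.prod_pow_eq_pow_sum, le_inv_mul_iff₀ (pow_pos hb0 _), ← pow_add]
          exact pow_le_pow_of_le_one hb0.le hb.le (by have := sum_entries_le T; omega)
  calc normalizedChar μ r θ
      ≤ ∑ T : ↥μ.cells → Fin r, ∏ j ∈ Finset.range (r - 1), θ j ^ charExponent T j :=
        Finset.sum_le_sum_of_subset_of_nonneg (Finset.filter_subset _ _)
          fun T _ _ => Finset.prod_nonneg fun j _ => (pow_pos (hpos j) _).le
    _ ≤ ∑ T : ↥μ.cells → Fin r, (b ^ N)⁻¹ * ∏ c, b ^ (T c : ℕ) :=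
        Finset.sum_le_sum fun T _ => hterm T
    _ = (b ^ N)⁻¹ * ∏ _c : ↥μ.cells, ∑ t : Fin r, b ^ (t : ℕ) := by
        rw [← Finset.mul_sum, Finset.prod_univ_sum, Fintype.piFinset_univ]
    _ ≤ _ := by
        refine mul_le_mul_of_nonneg_left ?_ (by positivity)
        refine Finset.prod_le_prod (fun _ _ => by positivity) fun _ _ => ?_
        rw [Fin.sum_univ_eq_sum_range (fun t => b ^ t), ← tsum_geometric_of_lt_one hb0.le hb]
        exact (summable_geometric_of_lt_one hb0.le hb).sum_le_tsum _ fun _ _ => by positivity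

theorem normalizedChar_le_succ (μ : YoungDiagram) {r : ℕ} (hr : 1 ≤ r) {θ : ℕ → ℝ}
    (hpos : ∀ i, 0 < θ i) : normalizedChar μ r θ ≤ normalizedChar μ (r + 1) θ := by
  rw [normalizedChar_eq, normalizedChar_eq]
  let e : (↥μ.cells → Fin r) ↪ (↥μ.cells → Fin (r + 1)) :=
    ⟨fun T c => (T c).castSucc, fun T T' h => funext fun c =>
      Fin.castSucc_injective r (congrFun h c)⟩
  have hterm : ∀ T : ↥μ.cells → Fin r,
      ∏ j ∈ Finset.range (r + 1 - 1), θ j ^ charExponent (e T) j =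
        ∏ j ∈ Finset.range (r - 1), θ j ^ charExponent T j := fun T => by
    obtain ⟨n, rfl⟩ : ∃ n, r = n + 1 := ⟨r - 1, by omega⟩
    rw [Nat.add_sub_cancel, Nat.add_sub_cancel, Finset.prod_range_succ]
    have h0 : charExponent (e T) n = 0 := by
      refine Nat.sub_eq_zero_of_le ((μ.sum_range_rowLen_le_card _).trans ?_)
      have hle : ∀ c, (e T c : ℕ) ≤ n := fun c => Nat.lt_succ_iff.mp (T c).2
      rw [Finset.filter_true_of_mem fun c _ => hle c]
      simp
    rw [h0, pow_zero, mul_one]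
    rfl
  rw [← Finset.sum_congr rfl fun T _ => hterm T,
    ← Finset.sum_map _ e (fun T => ∏ j ∈ Finset.range (r + 1 - 1), θ j ^ charExponent T j)]
  refine Finset.sum_le_sum_of_subset_of_nonneg ?_
    fun T _ _ => Finset.prod_nonneg fun j _ => (pow_pos (hpos j) _).le
  intro T' hT'
  obtain ⟨T, hmem, rfl⟩ := Finset.mem_map.mp hT'
  have hT := (Finset.mem_filter.mp hmem).2
  exact Finset.mem_filter.mpr ⟨Finset.mem_univ _, fun c c' h h' => hT.1 c c' h h',
    fun c c' h h' => hT.2 c c' h h'⟩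

theorem normalizedChar_pos (μ : YoungDiagram) {r : ℕ} (hr : μ.colLen 0 ≤ r) {θ : ℕ → ℝ}
    (hpos : ∀ i, 0 < θ i) : 0 < normalizedChar μ r θ := by
  refine Finset.sum_pos (fun T _ => Finset.prod_pos fun j _ => pow_pos (hpos j) _) ?_
  have hlt : ∀ c : ↥μ.cells, (c : ℕ × ℕ).1 < r := fun c => by
    have h : ((c : ℕ × ℕ).1, (c : ℕ × ℕ).2) ∈ μ := c.2
    exact (YoungDiagram.mem_iff_lt_colLen.mp
      (μ.up_left_mem le_rfl (Nat.zero_le _) h)).trans_le hr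
  exact ⟨fun c => ⟨(c : ℕ × ℕ).1, hlt c⟩, Finset.mem_filter.mpr ⟨Finset.mem_univ _,
    fun c c' h _ => Fin.mk_le_mk.mpr h.le, fun c c' _ h => Fin.mk_lt_mk.mpr h⟩⟩

theorem exists_tendsto_normalizedChar (μ : YoungDiagram) {θ : ℕ → ℝ} (hpos : ∀ i, 0 < θ i)
    {b : ℝ} (hb : b < 1) (hub : ∀ i, θ i ≤ b) :
    ∃ S : ℝ, 0 < S ∧ Tendsto (fun r : ℕ => normalizedChar μ r θ) atTop (nhds S) := by
  set m := μ.colLen 0 + 1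
  have hmono : Monotone fun r : ℕ => normalizedChar μ (r + m) θ := monotone_nat_of_le_succ
    fun r => by
      rw [Nat.add_right_comm]
      exact normalizedChar_le_succ μ (by omega) hpos
  have hbdd : BddAbove (Set.range fun r : ℕ => normalizedChar μ (r + m) θ) :=
    ⟨_, by rintro _ ⟨r, rfl⟩; exact normalizedChar_le μ _ hpos hb hub⟩
  refine ⟨_, ?_, (tendsto_add_atTop_iff_nat m).mp (tendsto_atTop_ciSup hmono hbdd)⟩
  exact (normalizedChar_pos μ (by omega) hpos).trans_le (le_ciSup hbdd 0)

theorem partialDiff_eq_card (lam del mu : YoungDiagram) {L j : ℕ}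
    (hL : ∀ k, L ≤ k → lam.rowLen k = 0 ∧ del.rowLen k = 0 ∧ mu.rowLen k = 0)
    (hj : L ≤ j + 1) :
    partialDiff lam del mu j = (lam.card : ℤ) + del.card - mu.card := by
  rw [partialDiff, Finset.sum_sub_distrib, Finset.sum_add_distrib,
    ← lam.sum_range_rowLen_eq_card (fun k hk => (hL k hk).1) hj,
    ← del.sum_range_rowLen_eq_card (fun k hk => (hL k hk).2.1) hj,
    ← mu.sum_range_rowLen_eq_card (fun k hk => (hL k hk).2.2) hj]
  push_cast
  rfl

theorem exists_forall_rowLen_eq_zero (lam del mu : YoungDiagram) :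
    ∃ L : ℕ, ∀ k, L ≤ k → lam.rowLen k = 0 ∧ del.rowLen k = 0 ∧ mu.rowLen k = 0 :=
  ⟨lam.colLen 0 + del.colLen 0 + mu.colLen 0, fun _ _ =>
    ⟨lam.rowLen_eq_zero_of_colLen_le (by omega), del.rowLen_eq_zero_of_colLen_le (by omega),
      mu.rowLen_eq_zero_of_colLen_le (by omega)⟩⟩

theorem prod_zpow_partialDiff_eq {lam del mu : YoungDiagram}
    (hcard : mu.card = lam.card + del.card) (θ : ℕ → ℝ) {L r : ℕ}
    (hL : ∀ k, L ≤ k → lam.rowLen k = 0 ∧ del.rowLen k = 0 ∧ mu.rowLen k = 0) (hr : L ≤ r) :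
    ∏ j ∈ Finset.range (r - 1), θ j ^ partialDiff lam del mu j =
      ∏ j ∈ Finset.range (L - 1), θ j ^ partialDiff lam del mu j := by
  refine (Finset.prod_subset (Finset.range_subset_range.mpr (by omega)) fun j _ hj => ?_).symm
  have hj : L ≤ j + 1 := by
    have := Finset.mem_range.not.mp hj
    omega
  rw [partialDiff_eq_card lam del mu hL hj, hcard]
  simp

theorem tendsto_prod_zpow_partialDiff {lam del mu : YoungDiagram}
    (hcard : mu.card < lam.card + del.card) {θ : ℕ → ℝ} (hpos : ∀ i, 0 < θ i)
    {b : ℝ} (hb : b < 1) (hub : ∀ i, θ i ≤ b) :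
    Tendsto (fun r : ℕ => ∏ j ∈ Finset.range (r - 1), θ j ^ partialDiff lam del mu j)
      atTop (nhds 0) := by
  have hb0 : 0 < b := (hpos 0).trans_le (hub 0)
  obtain ⟨L, hL⟩ := exists_forall_rowLen_eq_zero lam del mu
  obtain ⟨d, hd⟩ : ∃ d : ℕ, (lam.card : ℤ) + del.card - mu.card = (d + 1 : ℕ) :=
    ⟨lam.card + del.card - mu.card - 1, by omega⟩
  have hfac : ∀ j, L ≤ j → θ j ^ partialDiff lam del mu j ≤ b := fun j hj => by
    rw [partialDiff_eq_card lam del mu hL (by omega), hd, zpow_natCast]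
    exact (pow_le_of_le_one (hpos j).le ((hub j).trans hb.le) d.succ_ne_zero).trans (hub j)
  have hnn : ∀ j, 0 ≤ θ j ^ partialDiff lam del mu j := fun j => (zpow_pos (hpos j) _).le
  rw [← tendsto_add_atTop_iff_nat (L + 1)]
  have hlim : Tendsto (fun n : ℕ =>
      (∏ j ∈ Finset.range L, θ j ^ partialDiff lam del mu j) * b ^ n) atTop (nhds 0) := by
    simpa using (tendsto_pow_atTop_nhds_zero_of_lt_one hb0.le hb).const_mul
      (∏ j ∈ Finset.range L, θ j ^ partialDiff lam del mu j)
  refine squeeze_zero (fun n => Finset.prod_nonneg fun j _ => hnn j) (fun n => ?_) hlim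
  rw [show n + (L + 1) - 1 = L + n by omega, Finset.prod_range_add]
  refine mul_le_mul_of_nonneg_left ?_ (Finset.prod_nonneg fun j _ => hnn j)
  calc ∏ j ∈ Finset.range n, θ (L + j) ^ partialDiff lam del mu (L + j)
      ≤ ∏ _j ∈ Finset.range n, b :=
        Finset.prod_le_prod (fun j _ => hnn _) fun j _ => hfac _ (by omega)
    _ = b ^ n := by simp

/-- Type-A analytic content of the paper's main theorem. Let `λ, δ, μ` be partitions
with `|μ| ≤ |λ| + |δ|` and `θ = (θ_i)_{i≥1}` positive reals with `sup θ < 1`. Consider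
`R_r = (∏_{i=1}^{r−1} θ_i^{s_i}) · S_μ^{(r)}(θ) / (S_λ^{(r)}(θ) · S_δ^{(r)}(θ))`, with
`s_i = (λ_1+⋯+λ_i) + (δ_1+⋯+δ_i) − (μ_1+⋯+μ_i)` (integer powers). Then:
(1) if `|μ| = |λ| + |δ|`, denoting by `Sλ, Sδ, Sμ` the limits of the normalized
characters, for any `L` beyond which (1-indexed) all three partitions have only zero
parts, `R_r` converges to the positive real
`(∏_{i=1}^{L−1} θ_i^{s_i}) · Sμ / (Sλ · Sδ)`;
(2) if `|μ| < |λ| + |δ|`, then `R_r → 0`. -/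
theorem transition_ratio_limit (lam del mu : YoungDiagram)
    (hcard : mu.card ≤ lam.card + del.card)
    (θ : ℕ → ℝ) (hpos : ∀ i, 0 < θ i) (b : ℝ) (hb : b < 1) (hub : ∀ i, θ i ≤ b) :
    (mu.card = lam.card + del.card →
      ∃ Sl Sd Sm : ℝ,
        Tendsto (fun r : ℕ => normalizedChar lam r θ) atTop (nhds Sl) ∧
        Tendsto (fun r : ℕ => normalizedChar del r θ) atTop (nhds Sd) ∧
        Tendsto (fun r : ℕ => normalizedChar mu r θ) atTop (nhds Sm) ∧
        ∀ L : ℕ,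
          (∀ k, L ≤ k → lam.rowLen k = 0 ∧ del.rowLen k = 0 ∧ mu.rowLen k = 0) →
          0 < (∏ j ∈ Finset.range (L - 1), θ j ^ partialDiff lam del mu j) *
              Sm / (Sl * Sd) ∧
          Tendsto
            (fun r : ℕ =>
              (∏ j ∈ Finset.range (r - 1), θ j ^ partialDiff lam del mu j) *
                normalizedChar mu r θ /
                (normalizedChar lam r θ * normalizedChar del r θ))
            atTop
            (nhds ((∏ j ∈ Finset.range (L - 1), θ j ^ partialDiff lam del mu j) *
              Sm / (Sl * Sd)))) ∧
    (mu.card < lam.card + del.card →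
      Tendsto
        (fun r : ℕ =>
          (∏ j ∈ Finset.range (r - 1), θ j ^ partialDiff lam del mu j) *
            normalizedChar mu r θ /
            (normalizedChar lam r θ * normalizedChar del r θ))
        atTop (nhds 0)) := by
  obtain ⟨Sl, hSl, hl⟩ := exists_tendsto_normalizedChar lam hpos hb hub
  obtain ⟨Sd, hSd, hd⟩ := exists_tendsto_normalizedChar del hpos hb hub
  obtain ⟨Sm, hSm, hm⟩ := exists_tendsto_normalizedChar mu hpos hb hub
  have hne : Sl * Sd ≠ 0 := (mul_pos hSl hSd).ne'
  refine ⟨fun heq => ⟨Sl, Sd, Sm, hl, hd, hm, fun L hL => ⟨?_, ?_⟩⟩, fun hlt => ?_⟩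
  · exact div_pos (mul_pos (Finset.prod_pos fun j _ => zpow_pos (hpos j) _) hSm)
      (mul_pos hSl hSd)
  · refine Tendsto.div (Tendsto.mul ?_ hm) (hl.mul hd) hne
    refine tendsto_const_nhds.congr' ?_
    filter_upwards [eventually_ge_atTop L] with r hr
    exact (prod_zpow_partialDiff_eq heq θ hL hr).symm
  · have h := ((tendsto_prod_zpow_partialDiff hlt hpos hb hub).mul hm).div (hl.mul hd) hne
    rwa [zero_mul, zero_div] at h
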